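/- Let v_1, v_2 be non-decreasing submodular valuations for two agents over a finite set M of goods, and let (≻_1, ≻_2) be an α-approximate pure Nash equilibrium of the Round-Robin mechanism with resulting allocation (A_1, A_2). Then (A_1, A_2) is (α/2)-EF1 with respect to v_1, v_2: for each agent i and the other agent j, there exists g ∈ A_j such that v_i(A_i) ≥ (α/2)·v_i(A_j \ {g}). -/

import Mathlib

/-! Round-Robin mechanism: given reported strict total orders (duplicate-free lists
ranking the goods), in turns `t = 0, 1, 2, …` agent `t % n` receives her reported-top
good among those not yet allocated. -/

variable {G : Type*} [DecidableEq G]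

/-- Goods remaining after `t` turns of the Round-Robin mechanism. -/
def rrRemaining {n : ℕ} (hn : 0 < n) (pref : Fin n → List G) (goods : Finset G) :
    ℕ → Finset G
  | 0 => goods
  | t + 1 =>
    let S := rrRemaining hn pref goods t
    match (pref ⟨t % n, Nat.mod_lt t hn⟩).find? (fun g => decide (g ∈ S)) with
    | none => S
    | some g => S.erase g

/-- The good picked at turn `t` (agent `t % n` picks her reported-top available good). -/
def rrPicked {n : ℕ} (hn : 0 < n) (pref : Fin n → List G) (goods : Finset G) (t : ℕ) :
    Option G :=
  (pref ⟨t % n, Nat.mod_lt t hn⟩).find? fun g => decide (g ∈ rrRemaining hn pref goods t)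

/-- The bundle allocated to agent `i` by Round-Robin. -/
def rrBundle {n : ℕ} (hn : 0 < n) (pref : Fin n → List G) (goods : Finset G) (i : Fin n) :
    Finset G :=
  ((Finset.range goods.card).filter fun t => t % n = i.val).biUnion fun t =>
    (rrPicked hn pref goods t).toFinset

/-- Goods allocated strictly before turn `t`. -/
def rrAllocatedBefore {n : ℕ} (hn : 0 < n) (pref : Fin n → List G) (goods : Finset G)
    (t : ℕ) : Finset G := goods \ rrRemaining hn pref goods t

/-- A valid report is a strict total order on the goods: a duplicate-free list
enumerating exactly the goods. -/
def ValidReport (goods : Finset G) (l : List G) : Prop :=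
  l.Nodup ∧ ∀ g, g ∈ l ↔ g ∈ goods

/-- If `p t` is the reported-top good of the agent in turn among those outside
`p 0, …, p (t - 1)`, for every `t < m`, then the mechanism allocates `p 0, p 1, …` in order. -/
theorem rrRemaining_eq_sdiff_image {n : ℕ} (hn : 0 < n) (pref : Fin n → List G)
    (goods : Finset G) (p : ℕ → G) (m : ℕ)
    (hrun : ∀ t < m, (pref ⟨t % n, Nat.mod_lt t hn⟩).find?
      (fun g => decide (g ∈ goods \ (Finset.range t).image p)) = some (p t)) :
    ∀ t ≤ m, rrRemaining hn pref goods t = goods \ (Finset.range t).image p := by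
  intro t
  induction t with
  | zero => intro _; simp [rrRemaining]
  | succ t ih =>
    intro ht
    have h := hrun t ht
    rw [← ih (Nat.le_of_succ_le ht)] at h
    simp only [rrRemaining]
    rw [h, ih (Nat.le_of_succ_le ht)]
    ext g
    simp only [Finset.mem_erase, Finset.mem_sdiff, Finset.range_add_one, Finset.image_insert,
      Finset.mem_insert]
    tauto

theorem mem_rrBundle_of_rrPicked {n : ℕ} (hn : 0 < n) (pref : Fin n → List G)
    (goods : Finset G) (i : Fin n) {t : ℕ} (ht : t < goods.card) (hti : t % n = i.val) {g : G}
    (hg : rrPicked hn pref goods t = some g) : g ∈ rrBundle hn pref goods i := by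
  simp only [rrBundle, Finset.mem_biUnion, Finset.mem_filter, Finset.mem_range]
  exact ⟨t, ⟨ht, hti⟩, by simp [hg]⟩

theorem rrBundle_subset {n : ℕ} (hn : 0 < n) (pref : Fin n → List G) (goods : Finset G)
    (hvalid : ∀ i, ValidReport goods (pref i)) (i : Fin n) :
    rrBundle hn pref goods i ⊆ goods := by
  intro g hg
  simp only [rrBundle, Finset.mem_biUnion, Option.mem_toFinset, Option.mem_def] at hg
  obtain ⟨t, -, hg⟩ := hg
  exact ((hvalid _).2 g).1 (List.mem_of_find?_eq_some hg)

theorem ValidReport.length_eq {goods : Finset G} {l : List G} (h : ValidReport goods l) :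
    l.length = goods.card := by
  rw [← List.toFinset_card_of_nodup h.1]
  congr 1
  ext g
  simp [h.2 g]

/-- Against the report `pref j`, agent `i` can force the picking order
`(pref j)[σ 0], (pref j)[σ 1], …` for any involution `σ` of the turns under which each pick of
`j` is preceded by the picks of all goods `j` ranks higher. -/
theorem exists_report_getElem_mem_rrBundle (pref : Fin 2 → List G) (goods : Finset G)
    (i j : Fin 2) (hij : i ≠ j) (hj : ValidReport goods (pref j)) (σ : ℕ → ℕ)
    (hσ : ∀ t < goods.card, σ t < goods.card)
    (hinv : ∀ t < goods.card, σ (σ t) = t)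
    (hfirst : ∀ t < goods.card, t % 2 ≠ i.val → ∀ s < σ t, σ s < t) :
    ∃ l', ValidReport goods l' ∧ ∀ t (h : t < (pref j).length), σ t % 2 = i.val →
      (pref j)[t] ∈ rrBundle (n := 2) (by norm_num) (Function.update pref i l') goods i := by
  obtain hempty | ⟨x, -⟩ := goods.eq_empty_or_nonempty
  · refine ⟨pref j, hj, fun t h => ?_⟩
    rw [hj.length_eq, hempty] at h
    simp at h
  set L := pref j with hL
  have hlen : L.length = goods.card := hj.length_eq
  set p : ℕ → G := fun t => L.getD (σ t) x with hp
  have hpL : ∀ s (h : s < L.length), p (σ s) = L[s] := fun s h => by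
    simp [hp, hinv s (hlen ▸ h), h]
  have hpmem : ∀ t < goods.card, p t ∈ goods := fun t ht => by
    have h : σ t < L.length := hlen ▸ hσ t ht
    rw [← hj.2, ← hinv t ht, hpL _ h]
    exact List.getElem_mem h
  have hpinj : ∀ s < goods.card, ∀ t < goods.card, p s = p t → s = t := by
    intro s hs t ht hst
    have h₁ : σ s < L.length := hlen ▸ hσ s hs
    have h₂ : σ t < L.length := hlen ▸ hσ t ht
    rw [← hinv s hs, ← hinv t ht, hpL _ h₁, hpL _ h₂, hj.1.getElem_inj_iff] at hst
    rw [← hinv s hs, hst, hinv t ht]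
  have hfresh : ∀ t < goods.card, p t ∈ goods \ (Finset.range t).image p := by
    intro t ht
    simp only [Finset.mem_sdiff, Finset.mem_image, Finset.mem_range, not_exists, not_and]
    refine ⟨hpmem t ht, fun s hs hst => ?_⟩
    have := hpinj s (hs.trans ht) t ht hst
    omega
  refine ⟨(List.range goods.card).map p, ⟨?_, fun g => ?_⟩, ?_⟩
  · refine List.Nodup.map_on (fun s hs t ht => ?_) List.nodup_range
    exact hpinj s (List.mem_range.1 hs) t (List.mem_range.1 ht)
  · simp only [List.mem_map, List.mem_range]
    constructor
    · rintro ⟨t, ht, rfl⟩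
      exact hpmem t ht
    · intro hg
      obtain ⟨s, hs, rfl⟩ := List.getElem_of_mem ((hj.2 g).2 hg)
      exact ⟨σ s, hσ s (hlen ▸ hs), hpL s hs⟩
  set pref' := Function.update pref i ((List.range goods.card).map p) with hpref'
  have hrun : ∀ t < goods.card, (pref' ⟨t % 2, Nat.mod_lt t (by norm_num)⟩).find?
      (fun g => decide (g ∈ goods \ (Finset.range t).image p)) = some (p t) := by
    intro t ht
    rw [List.find?_eq_some_iff_getElem]
    refine ⟨decide_eq_true (hfresh t ht), ?_⟩
    by_cases hti : t % 2 = i.val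
    · have hi : (⟨t % 2, Nat.mod_lt t (by norm_num)⟩ : Fin 2) = i := Fin.ext hti
      rw [hi, hpref', Function.update_self]
      refine ⟨t, by simpa using ht, by simp, fun s hs => ?_⟩
      have : p s ∈ (Finset.range t).image p :=
        Finset.mem_image_of_mem p (Finset.mem_range.2 hs)
      simp only [List.getElem_map, List.getElem_range, Finset.mem_sdiff, this]
      simp
    · have hj' : (⟨t % 2, Nat.mod_lt t (by norm_num)⟩ : Fin 2) = j := by
        apply Fin.ext
        have : i.val ≠ j.val := fun h => hij (Fin.ext h)
        simp only
        omega
      rw [hj', hpref', Function.update_of_ne hij.symm, ← hL]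
      have hlt : σ t < L.length := hlen ▸ hσ t ht
      refine ⟨σ t, hlt, by rw [← hpL _ hlt, hinv t ht], fun s hs => ?_⟩
      have : L[s] ∈ (Finset.range t).image p := by
        rw [← hpL s (hs.trans hlt)]
        exact Finset.mem_image_of_mem p (Finset.mem_range.2 (hfirst t ht hti s hs))
      simp only [Finset.mem_sdiff, this]
      simp
  intro t h hti
  have hσt : σ t < goods.card := hσ t (hlen ▸ h)
  refine mem_rrBundle_of_rrPicked _ pref' goods i hσt hti ?_
  rw [rrPicked, rrRemaining_eq_sdiff_image _ pref' goods p goods.card hrun _ hσt.le,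
    hrun _ hσt, hpL t h]

theorem union_le_add_of_submodular {v : Finset G → ℝ} (hnn : 0 ≤ v ∅)
    (hmono : ∀ S T : Finset G, S ⊆ T → v S ≤ v T)
    (hsub : ∀ S T : Finset G, ∀ g, S ⊆ T → g ∉ T →
      v (insert g T) - v T ≤ v (insert g S) - v S) (S T : Finset G) :
    v (S ∪ T) ≤ v S + v T := by
  induction T using Finset.induction_on with
  | empty => simpa using hnn
  | insert g T _ ih =>
    by_cases hg : g ∈ S ∪ T
    · rw [Finset.union_insert, Finset.insert_eq_of_mem hg]
      linarith [hmono _ _ (Finset.subset_insert g T)]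
    · rw [Finset.union_insert]
      linarith [hsub T (S ∪ T) g Finset.subset_union_right hg]

/-- Agent `i` has two deviations whose bundles cover all goods, except possibly `j`'s
reported-top good when `i` picks second. -/
theorem exists_two_reports_cover (pref : Fin 2 → List G) (goods : Finset G)
    (i j : Fin 2) (hij : i ≠ j) (hj : ValidReport goods (pref j)) :
    ∃ l₁ l₂, ValidReport goods l₁ ∧ ValidReport goods l₂ ∧
      ∀ t (h : t < (pref j).length), (t = 0 → i = 0) → (pref j)[t] ∈
        rrBundle (n := 2) (by norm_num) (Function.update pref i l₁) goods i ∪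
        rrBundle (n := 2) (by norm_num) (Function.update pref i l₂) goods i := by
  obtain ⟨l₁, hl₁, h₁⟩ := exists_report_getElem_mem_rrBundle pref goods i j hij hj id
    (fun _ h => h) (fun _ _ => rfl) (fun _ _ _ _ h => h)
  obtain ⟨l₂, hl₂, h₂⟩ := exists_report_getElem_mem_rrBundle pref goods i j hij hj
    (fun t => if t % 2 = i.val then (if t + 1 < goods.card then t + 1 else t) else t - 1)
    (fun t ht => by split_ifs <;> omega)
    (fun t ht => by have := i.isLt; split_ifs <;> omega)
    (fun t ht hti s hs => by
      rw [if_neg hti] at hs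
      split_ifs <;> omega)
  refine ⟨l₁, l₂, hl₁, hl₂, fun t h h0 => Finset.mem_union.2 ?_⟩
  by_cases hti : t % 2 = i.val
  · exact Or.inl (h₁ t h hti)
  · refine Or.inr (h₂ t h ?_)
    rw [if_neg hti]
    have := i.isLt
    have ht : t ≠ 0 := by
      rintro rfl
      exact hti (by simp [h0 rfl])
    omega

/-- For two agents with non-decreasing submodular valuations, any `α`-approximate pure
Nash equilibrium of the Round-Robin mechanism yields an `(α/2)`-EF1 allocation with
respect to the true valuations. -/
theorem two_agent_submodular_PNE_half_EF1 {k : ℕ}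
    (goods : Finset G) (hm : goods.card = k * 2)
    (v : Fin 2 → Finset G → ℝ)
    (hnn : ∀ i S, 0 ≤ v i S)
    (hmono : ∀ i, ∀ S T : Finset G, S ⊆ T → v i S ≤ v i T)
    (hsub : ∀ i, ∀ S T : Finset G, ∀ g, S ⊆ T → g ∉ T →
      v i (insert g T) - v i T ≤ v i (insert g S) - v i S)
    (α : ℝ) (hα0 : 0 < α) (hα1 : α ≤ 1)
    (pref : Fin 2 → List G)
    (hvalid : ∀ i, ValidReport goods (pref i))
    (hpne : ∀ (i : Fin 2) (l' : List G), ValidReport goods l' →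
      α * v i (rrBundle (n := 2) (by norm_num) (Function.update pref i l') goods i) ≤
        v i (rrBundle (n := 2) (by norm_num) pref goods i))
    (i j : Fin 2) (hij : i ≠ j)
    (hne : (rrBundle (n := 2) (by norm_num) pref goods j).Nonempty) :
    ∃ g ∈ rrBundle (n := 2) (by norm_num) pref goods j,
      v i (rrBundle (n := 2) (by norm_num) pref goods i) ≥
        (α / 2) * v i ((rrBundle (n := 2) (by norm_num) pref goods j).erase g) := by
  suffices h : ∃ g ∈ rrBundle (n := 2) (by norm_num) pref goods j,
      ∀ t (h : t < (pref j).length), (pref j)[t] ≠ g → t = 0 → i = 0 by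
    obtain ⟨g, hg, hcov⟩ := h
    refine ⟨g, hg, ?_⟩
    obtain ⟨l₁, l₂, hl₁, hl₂, hl⟩ := exists_two_reports_cover pref goods i j hij (hvalid j)
    have hsubset : (rrBundle (n := 2) (by norm_num) pref goods j).erase g ⊆
        rrBundle (n := 2) (by norm_num) (Function.update pref i l₁) goods i ∪
        rrBundle (n := 2) (by norm_num) (Function.update pref i l₂) goods i := by
      intro x hx
      obtain ⟨hxg, hx⟩ := Finset.mem_erase.1 hx
      obtain ⟨t, ht, rfl⟩ := List.getElem_of_mem
        (((hvalid j).2 x).2 (rrBundle_subset _ pref goods hvalid j hx))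
      exact hl t ht (hcov t ht hxg)
    have hle := (hmono i _ _ hsubset).trans
      (union_le_add_of_submodular (hnn i ∅) (hmono i) (hsub i) _ _)
    nlinarith [hpne i l₁ hl₁, hpne i l₂ hl₂, mul_le_mul_of_nonneg_left hle hα0.le]
  by_cases hi : i = 0
  · obtain ⟨g, hg⟩ := hne
    exact ⟨g, hg, fun _ _ _ _ => hi⟩
  · have hj : j = 0 := by omega
    subst hj
    obtain ⟨x, hx⟩ := hne
    have hpos : 0 < goods.card :=
      Finset.card_pos.2 ⟨x, rrBundle_subset _ pref goods hvalid 0 hx⟩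
    have hlen : 0 < (pref 0).length := (hvalid 0).length_eq ▸ hpos
    refine ⟨(pref 0)[0], mem_rrBundle_of_rrPicked _ pref goods 0 hpos rfl ?_, ?_⟩
    · change (pref 0).find? (fun g => decide (g ∈ goods)) = _
      rw [List.find?_eq_some_iff_getElem]
      exact ⟨decide_eq_true (((hvalid 0).2 _).1 (List.getElem_mem hlen)), 0, hlen, rfl,
        fun s hs => absurd hs (Nat.not_lt_zero s)⟩
    · rintro t ht hne rfl
      exact absurd rfl hne
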